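/- arXiv:1002.3627 — 2 statements merged into one kernel-verified Lean document; each statement's English description precedes it below -/
import Mathlib

section
/- Let (ρ_t)_{t∈ℕ} be a dynamic convex risk measure for processes. Then (ρ_t) is time consistent if and only if for every t ∈ ℕ the acceptance sets split as 𝒜_t = 𝒜_{t,t+1} + 𝒜_{t+1}, i.e. 𝒜_t = {Y + Z : Y ∈ 𝒜_{t,t+1}, Z ∈ 𝒜_{t+1}} with componentwise addition of processes. -/
open MeasureTheory Filter

variable {Ω : Type*}

/-- Bounded measurable real-valued functions with respect to a σ-algebra (the space `L^∞`). -/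
def BddMeas {α : Type*} (mm : MeasurableSpace α) (f : α → ℝ) : Prop :=
  Measurable[mm] f ∧ ∃ C : ℝ, ∀ x, |f x| ≤ C

/-- The space `ℛ^∞` of bounded adapted processes. -/
def MemRinf {m : MeasurableSpace Ω} (F : Filtration ℕ m) (X : ℕ → Ω → ℝ) : Prop :=
  (∀ s, Measurable[F s] (X s)) ∧ ∃ C : ℝ, ∀ s ω, |X s ω| ≤ C

/-- The projection `π_t` killing a process strictly before time `t`. -/
def projt (t : ℕ) (X : ℕ → Ω → ℝ) : ℕ → Ω → ℝ := fun r ω => if t ≤ r then X r ω else 0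

/-- Membership in `ℛ_t^∞ = π_t(ℛ^∞)`: bounded adapted processes vanishing before `t`. -/
def MemRt {m : MeasurableSpace Ω} (F : Filtration ℕ m) (t : ℕ) (X : ℕ → Ω → ℝ) : Prop :=
  MemRinf F X ∧ ∀ r < t, ∀ ω, X r ω = 0

/-- A conditional convex risk measure for processes at time `t`:  a map
`ρ_t : ℛ_t^∞ → L^∞_t` which is conditionally cash invariant, monotone, conditionally
convex and normalized. -/
structure IsCondRiskMeasure {m : MeasurableSpace Ω} (F : Filtration ℕ m) (P : Measure Ω)
    (t : ℕ) (ρ : (ℕ → Ω → ℝ) → Ω → ℝ) : Prop where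
  map_into : ∀ X, MemRt F t X → BddMeas (F t) (ρ X)
  cash : ∀ X, MemRt F t X → ∀ mf : Ω → ℝ, BddMeas (F t) mf →
    ρ (fun r ω => X r ω + if t ≤ r then mf ω else 0) =ᵐ[P] fun ω => ρ X ω - mf ω
  mono : ∀ X Y, MemRt F t X → MemRt F t Y → (∀ s, ∀ᵐ ω ∂P, X s ω ≤ Y s ω) →
    ∀ᵐ ω ∂P, ρ Y ω ≤ ρ X ω
  convex : ∀ X Y, MemRt F t X → MemRt F t Y → ∀ lam : Ω → ℝ,
    Measurable[F t] lam → (∀ ω, 0 ≤ lam ω ∧ lam ω ≤ 1) →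
    ∀ᵐ ω ∂P, ρ (fun r ω => lam ω * X r ω + (1 - lam ω) * Y r ω) ω ≤
      lam ω * ρ X ω + (1 - lam ω) * ρ Y ω
  norm : ρ (fun _ _ => 0) =ᵐ[P] (0 : Ω → ℝ)

/-- Time consistency of a dynamic convex risk measure for processes. -/
def TimeConsistent {m : MeasurableSpace Ω} (F : Filtration ℕ m) (P : Measure Ω)
    (ρ : ℕ → (ℕ → Ω → ℝ) → Ω → ℝ) : Prop :=
  ∀ t (X Y : ℕ → Ω → ℝ), MemRinf F X → MemRinf F Y →
    X t =ᵐ[P] Y t →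
    (∀ᵐ ω ∂P, ρ (t + 1) (projt (t + 1) X) ω ≤ ρ (t + 1) (projt (t + 1) Y) ω) →
    ∀ᵐ ω ∂P, ρ t (projt t X) ω ≤ ρ t (projt t Y) ω

/-- The process `X_t·1_{{t}} − ρ_{t+1}(X)·1_{𝕋_{t+1}}`. -/
def oneStepTarget (ρ : ℕ → (ℕ → Ω → ℝ) → Ω → ℝ) (t : ℕ) (X : ℕ → Ω → ℝ) :
    ℕ → Ω → ℝ :=
  fun r ω => if r = t then X t ω else if t + 1 ≤ r then -ρ (t + 1) (projt (t + 1) X) ω else 0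

/-- The acceptance set `𝒜_t` of a conditional convex risk measure for processes. -/
def AcceptSet {m : MeasurableSpace Ω} (F : Filtration ℕ m) (P : Measure Ω) (t : ℕ)
    (ρ : (ℕ → Ω → ℝ) → Ω → ℝ) : Set (ℕ → Ω → ℝ) :=
  {X | MemRt F t X ∧ ∀ᵐ ω ∂P, ρ X ω ≤ 0}

/-- The one-step acceptance set `𝒜_{t,t+1}`: acceptable processes in `ℛ_{t,t+1}^∞`. -/
def AcceptSetStep {m : MeasurableSpace Ω} (F : Filtration ℕ m) (P : Measure Ω) (t : ℕ)
    (ρ : (ℕ → Ω → ℝ) → Ω → ℝ) : Set (ℕ → Ω → ℝ) :=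
  {X | MemRt F t X ∧ (∀ r, t + 1 ≤ r → X r = X (t + 1)) ∧ ∀ᵐ ω ∂P, ρ X ω ≤ 0}

section AdaptedProcesses

variable {m : MeasurableSpace Ω} {F : Filtration ℕ m} {P : Measure Ω} {s t : ℕ}
  {X Y : ℕ → Ω → ℝ} {c d : Ω → ℝ}

theorem BddMeas.mono (hst : s ≤ t) (h : BddMeas (F s) c) : BddMeas (F t) c :=
  ⟨h.1.mono (F.mono hst) le_rfl, h.2⟩

theorem BddMeas.neg {mm : MeasurableSpace Ω} (h : BddMeas mm c) :
    BddMeas mm (fun ω => -c ω) := by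
  obtain ⟨hm, C, hC⟩ := h
  exact ⟨hm.neg, C, fun ω => by simpa using hC ω⟩

theorem BddMeas.add {mm : MeasurableSpace Ω} (hc : BddMeas mm c) (hd : BddMeas mm d) :
    BddMeas mm (fun ω => c ω + d ω) := by
  obtain ⟨hcm, C, hC⟩ := hc
  obtain ⟨hdm, D, hD⟩ := hd
  exact ⟨hcm.add hdm, C + D, fun ω => (abs_add_le _ _).trans (add_le_add (hC ω) (hD ω))⟩

theorem MemRinf.bddMeas (h : MemRinf F X) (t : ℕ) : BddMeas (F t) (X t) :=
  ⟨h.1 t, h.2.imp fun _ hC => hC t⟩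

theorem MemRinf.add (hX : MemRinf F X) (hY : MemRinf F Y) :
    MemRinf F (fun r ω => X r ω + Y r ω) := by
  obtain ⟨hXm, C, hC⟩ := hX
  obtain ⟨hYm, D, hD⟩ := hY
  exact ⟨fun r => (hXm r).add (hYm r), C + D,
    fun r ω => (abs_add_le _ _).trans (add_le_add (hC r ω) (hD r ω))⟩

theorem MemRt.add (hX : MemRt F t X) (hY : MemRt F t Y) :
    MemRt F t (fun r ω => X r ω + Y r ω) :=
  ⟨hX.1.add hY.1, fun r hr ω => by simp [hX.2 r hr, hY.2 r hr]⟩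

theorem MemRt.anti (hst : s ≤ t) (h : MemRt F t X) : MemRt F s X :=
  ⟨h.1, fun r hr => h.2 r (hr.trans_le hst)⟩

theorem MemRinf.projt (h : MemRinf F X) (t : ℕ) : MemRt F t (projt t X) := by
  obtain ⟨hm, C, hC⟩ := h
  refine ⟨⟨fun r => ?_, C, fun r ω => ?_⟩, fun r hr ω => by simp [_root_.projt, hr]⟩
  · unfold _root_.projt
    by_cases hr : t ≤ r
    · simpa only [hr, if_true] using hm r
    · simp only [hr, if_false, measurable_const]
  · by_cases hr : t ≤ r
    · simpa [_root_.projt, hr] using hC r ω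
    · simpa [_root_.projt, hr] using (abs_nonneg _).trans (hC r ω)

theorem projt_of_memRt (h : MemRt F t X) : projt t X = X := by
  funext r ω
  by_cases hr : t ≤ r
  · simp [projt, hr]
  · simp [projt, hr, h.2 r (not_le.mp hr) ω]

theorem memRt_cash (h : BddMeas (F t) c) :
    MemRt F t (fun r ω => if t ≤ r then c ω else 0) := by
  obtain ⟨hm, C, hC⟩ := h
  refine ⟨⟨fun r => ?_, C, fun r ω => ?_⟩, fun r hr ω => by simp [hr]⟩
  · by_cases hr : t ≤ r
    · simpa [hr] using hm.mono (F.mono hr) le_rfl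
    · simp [hr]
  · by_cases hr : t ≤ r
    · simpa [hr] using hC ω
    · simpa [hr] using (abs_nonneg _).trans (hC ω)

theorem memRt_single (h : BddMeas (F t) c) :
    MemRt F t (fun r ω => if r = t then c ω else 0) := by
  obtain ⟨hm, C, hC⟩ := h
  refine ⟨⟨fun r => ?_, C, fun r ω => ?_⟩, fun r hr ω => by simp [hr.ne]⟩
  · by_cases hr : r = t
    · subst hr
      simpa using hm
    · simp [hr]
  · by_cases hr : r = t
    · simpa [hr] using hC ω
    · simpa [hr] using (abs_nonneg _).trans (hC ω)

end AdaptedProcesses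

section RiskMeasures

variable {m : MeasurableSpace Ω} {F : Filtration ℕ m} {P : Measure Ω} {t : ℕ}
  {X Y : ℕ → Ω → ℝ} {c : Ω → ℝ}

theorem IsCondRiskMeasure.ae_congr {ρ : (ℕ → Ω → ℝ) → Ω → ℝ} (hρ : IsCondRiskMeasure F P t ρ)
    (hX : MemRt F t X) (hY : MemRt F t Y) (h : ∀ s, X s =ᵐ[P] Y s) : ρ X =ᵐ[P] ρ Y := by
  filter_upwards [hρ.mono X Y hX hY fun s => (h s).le,
    hρ.mono Y X hY hX fun s => (h s).symm.le] with ω h₁ h₂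
  exact le_antisymm h₂ h₁

theorem IsCondRiskMeasure.apply_cash {ρ : (ℕ → Ω → ℝ) → Ω → ℝ} (hρ : IsCondRiskMeasure F P t ρ)
    (hc : BddMeas (F t) c) :
    ρ (fun r ω => if t ≤ r then c ω else 0) =ᵐ[P] fun ω => -c ω := by
  have hzero : MemRt F t (fun _ _ => 0) :=
    ⟨⟨fun _ => measurable_const, 0, fun _ _ => by simp⟩, fun _ _ _ => rfl⟩
  have h := hρ.cash _ hzero c hc
  simp only [zero_add] at h
  filter_upwards [h, hρ.norm] with ω h₁ h₂
  rw [h₁, h₂, Pi.zero_apply, zero_sub]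

variable {ρ : ℕ → (ℕ → Ω → ℝ) → Ω → ℝ}

theorem oneStepTarget_eq_add (ρ : ℕ → (ℕ → Ω → ℝ) → Ω → ℝ) (t : ℕ) (X : ℕ → Ω → ℝ) :
    oneStepTarget ρ t X = fun r ω => (if r = t then X t ω else 0) +
      if t + 1 ≤ r then -ρ (t + 1) (projt (t + 1) X) ω else 0 := by
  funext r ω
  by_cases hr : r = t <;> simp [oneStepTarget, hr]

theorem projt_succ_of_step (hX : ∀ r, t + 1 ≤ r → X r = X (t + 1)) :
    projt (t + 1) X = fun r ω => if t + 1 ≤ r then X (t + 1) ω else 0 := by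
  funext r ω
  by_cases hr : t + 1 ≤ r
  · simp [projt, hr, hX r hr]
  · simp [projt, hr]

theorem memRt_oneStepTarget (hρ : IsCondRiskMeasure F P (t + 1) (ρ (t + 1)))
    (hX : MemRinf F X) : MemRt F t (oneStepTarget ρ t X) := by
  rw [oneStepTarget_eq_add]
  exact (memRt_single (hX.bddMeas t)).add
    ((memRt_cash (hρ.map_into _ (hX.projt (t + 1))).neg).anti t.le_succ)

theorem TimeConsistent.oneStepTarget_le (hTC : TimeConsistent F P ρ)
    (hρ : IsCondRiskMeasure F P (t + 1) (ρ (t + 1))) (hX : MemRt F t X) :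
    ∀ᵐ ω ∂P, ρ t (oneStepTarget ρ t X) ω ≤ ρ t X ω := by
  have hT := memRt_oneStepTarget hρ hX.1
  have h := hTC t (oneStepTarget ρ t X) X hT.1 hX.1
    (Eventually.of_forall fun ω => by simp [oneStepTarget]) ?_
  · rwa [projt_of_memRt hT, projt_of_memRt hX] at h
  · have hproj : projt (t + 1) (oneStepTarget ρ t X) = fun r ω =>
        if t + 1 ≤ r then -ρ (t + 1) (projt (t + 1) X) ω else 0 := by
      rw [projt_succ_of_step]
      · simp [oneStepTarget]
      · intro r hr
        funext ω
        have hne : r ≠ t := by omega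
        simp [oneStepTarget, hr, hne]
    rw [hproj]
    filter_upwards [hρ.apply_cash (hρ.map_into _ (hX.1.projt (t + 1))).neg] with ω hω
    rw [hω, neg_neg]

theorem TimeConsistent.exists_split (hTC : TimeConsistent F P ρ)
    (hρ : IsCondRiskMeasure F P (t + 1) (ρ (t + 1))) (hX : X ∈ AcceptSet F P t (ρ t)) :
    ∃ Y ∈ AcceptSetStep F P t (ρ t), ∃ W ∈ AcceptSet F P (t + 1) (ρ (t + 1)),
      X = fun r ω => Y r ω + W r ω := by
  obtain ⟨hXm, hXa⟩ := hX
  have hp := hXm.1.projt (t + 1)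
  have hc := hρ.map_into _ hp
  refine ⟨oneStepTarget ρ t X, ⟨memRt_oneStepTarget hρ hXm.1, fun r hr => ?_, ?_⟩,
    fun r ω => projt (t + 1) X r ω + if t + 1 ≤ r then ρ (t + 1) (projt (t + 1) X) ω else 0,
    ⟨hp.add (memRt_cash hc), ?_⟩, ?_⟩
  · funext ω
    have hne : r ≠ t := by omega
    simp [oneStepTarget, hr, hne]
  · filter_upwards [hTC.oneStepTarget_le hρ hXm, hXa] with ω h₁ h₂
    exact h₁.trans h₂
  · filter_upwards [hρ.cash _ hp _ hc] with ω hω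
    rw [hω, sub_self]
  · funext r ω
    rcases lt_trichotomy r t with hr | rfl | hr
    · have h₁ : ¬ t + 1 ≤ r := by omega
      simp [oneStepTarget, projt, h₁, hr.ne, hXm.2 r hr ω]
    · simp [oneStepTarget, projt]
    · simp [oneStepTarget, projt, Nat.succ_le_of_lt hr, hr.ne']

theorem TimeConsistent.add_mem_acceptSet (hTC : TimeConsistent F P ρ)
    (hρ : IsCondRiskMeasure F P (t + 1) (ρ (t + 1))) (hY : Y ∈ AcceptSetStep F P t (ρ t))
    {W : ℕ → Ω → ℝ} (hW : W ∈ AcceptSet F P (t + 1) (ρ (t + 1))) :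
    (fun r ω => Y r ω + W r ω) ∈ AcceptSet F P t (ρ t) := by
  obtain ⟨hYm, hYs, hYa⟩ := hY
  obtain ⟨hWm, hWa⟩ := hW
  have hZ := hYm.add (hWm.anti t.le_succ)
  have hc := hYm.1.bddMeas (t + 1)
  have hproj : projt (t + 1) (fun r ω => Y r ω + W r ω) =
      fun r ω => W r ω + if t + 1 ≤ r then Y (t + 1) ω else 0 := by
    funext r ω
    by_cases hr : t + 1 ≤ r
    · simp [projt, hr, hYs r hr, add_comm]
    · simp [projt, hr, hWm.2 r (not_le.mp hr) ω]
  have h := hTC t _ Y hZ.1 hYm.1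
    (Eventually.of_forall fun ω => by simp [hWm.2 t t.lt_succ_self ω]) ?_
  · rw [projt_of_memRt hZ, projt_of_memRt hYm] at h
    refine ⟨hZ, ?_⟩
    filter_upwards [h, hYa] with ω h₁ h₂
    exact h₁.trans h₂
  · rw [hproj, projt_succ_of_step hYs]
    filter_upwards [hρ.cash _ hWm _ hc, hρ.apply_cash hc, hWa] with ω h₁ h₂ h₃
    rw [h₁, h₂]
    linarith

theorem timeConsistent_of_acceptSet_eq_add (hρ : ∀ t, IsCondRiskMeasure F P t (ρ t))
    (hsplit : ∀ t, AcceptSet F P t (ρ t) =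
      {Z | ∃ Y ∈ AcceptSetStep F P t (ρ t), ∃ W ∈ AcceptSet F P (t + 1) (ρ (t + 1)),
        Z = fun r ω => Y r ω + W r ω}) :
    TimeConsistent F P ρ := by
  intro t X Y hX hY hXY hle
  have hXt := hX.projt t
  have hYt := hY.projt t
  have hb := (hρ t).map_into _ hYt
  have hmem : (fun r ω => projt t Y r ω + if t ≤ r then ρ t (projt t Y) ω else 0) ∈
      AcceptSet F P t (ρ t) := by
    refine ⟨hYt.add (memRt_cash hb), ?_⟩
    filter_upwards [(hρ t).cash _ hYt _ hb] with ω hω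
    simp [hω]
  rw [hsplit t] at hmem
  obtain ⟨A, ⟨hAm, hAs, hAa⟩, B, ⟨hBm, hBa⟩, hAB⟩ := hmem
  have hpt : ∀ r ω, projt t Y r ω + (if t ≤ r then ρ t (projt t Y) ω else 0) =
      A r ω + B r ω := fun r ω => congrFun (congrFun hAB r) ω
  have hc : BddMeas (F (t + 1)) (fun ω => ρ t (projt t Y) ω + -A (t + 1) ω) :=
    (hb.mono t.le_succ).add (hAm.1.bddMeas (t + 1)).neg
  have hB : B = fun r ω => projt (t + 1) Y r ω +
      if t + 1 ≤ r then ρ t (projt t Y) ω + -A (t + 1) ω else 0 := by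
    funext r ω
    by_cases hr : t + 1 ≤ r
    · have h := hpt r ω
      have hr' : t ≤ r := by omega
      simp only [projt, hr, hr', hAs r hr, if_true] at h ⊢
      linarith
    · simp [projt, hr, hBm.2 r (not_le.mp hr) ω]
  have hXs := hX.projt (t + 1)
  have hYs := hY.projt (t + 1)
  have hB' : (fun r ω => projt (t + 1) X r ω +
      if t + 1 ≤ r then ρ t (projt t Y) ω + -A (t + 1) ω else 0) ∈
      AcceptSet F P (t + 1) (ρ (t + 1)) := by
    refine ⟨hXs.add (memRt_cash hc), ?_⟩
    rw [hB] at hBa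
    filter_upwards [(hρ (t + 1)).cash _ hXs _ hc, (hρ (t + 1)).cash _ hYs _ hc, hBa, hle]
      with ω h₁ h₂ h₃ h₄
    rw [h₂] at h₃
    rw [h₁]
    linarith
  obtain ⟨hSm, hSa⟩ := (hsplit t).ge ⟨A, ⟨hAm, hAs, hAa⟩, _, hB', rfl⟩
  have hcongr := (hρ t).ae_congr (hXt.add (memRt_cash hb)) hSm fun r => by
    filter_upwards [hXY] with ω hω
    rcases lt_trichotomy r t with hr | rfl | hr
    · have h₁ : ¬ t + 1 ≤ r := by omega
      simp [projt, h₁, not_le.mpr hr, hAm.2 r hr ω]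
    · have h := hpt r ω
      simp only [hBm.2 r r.lt_succ_self ω, projt, le_refl, if_true, add_zero] at h
      simp [projt, hω, h]
    · have hr' : t + 1 ≤ r := hr
      simp only [projt, hr', hr.le, hAs r hr', if_true]
      ring
  filter_upwards [hcongr, hSa, (hρ t).cash _ hXt _ hb] with ω h₁ h₂ h₃
  rw [← h₁, h₃] at h₂
  linarith

end RiskMeasures

/-- **Time consistency is equivalent to the splitting of acceptance sets.**
A dynamic convex risk measure for processes `(ρ_t)` is time consistent if and only if for
every `t` the acceptance sets satisfy `𝒜_t = 𝒜_{t,t+1} + 𝒜_{t+1}` (setwise sum with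
componentwise addition of processes). -/
theorem stmt_8 {Ω : Type*} {m : MeasurableSpace Ω} (F : Filtration ℕ m)
    (P : Measure Ω) [IsProbabilityMeasure P]
    (hF0 : ∀ A : Set Ω, MeasurableSet[F 0] A → P A = 0 ∨ P A = 1)
    (ρ : ℕ → (ℕ → Ω → ℝ) → Ω → ℝ)
    (hρ : ∀ t, IsCondRiskMeasure F P t (ρ t)) :
    TimeConsistent F P ρ ↔
      ∀ t, AcceptSet F P t (ρ t) =
        {Z | ∃ Y ∈ AcceptSetStep F P t (ρ t), ∃ W ∈ AcceptSet F P (t + 1) (ρ (t + 1)),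
          Z = fun r ω => Y r ω + W r ω} := by
  refine ⟨fun hTC t => Set.Subset.antisymm
    (fun _ hX => hTC.exists_split (hρ (t + 1)) hX) ?_, timeConsistent_of_acceptSet_eq_add hρ⟩
  rintro _ ⟨Y, hY, W, hW, rfl⟩
  exact hTC.add_mem_acceptSet (hρ (t + 1)) hY hW
end

section
/- Let (ρ_t)_{t∈ℕ} be a dynamic convex risk measure for processes. Then (ρ_t) is weakly acceptance consistent, i.e. for all t ∈ ℕ and all X ∈ ℛ^∞, X_t = 0 P-a.s. and ρ_{t+1}(X) ≤ 0 P-a.s. imply ρ_t(X) ≤ 0 P-a.s., if and only if the acceptance sets are nested: 𝒜_{t+1} ⊆ 𝒜_t for every t ∈ ℕ. -/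
open MeasureTheory Filter

variable {Ω : Type*}

theorem projt_eq_self {Ω : Type*} {t : ℕ} {X : ℕ → Ω → ℝ} (h : ∀ r < t, ∀ ω, X r ω = 0) :
    projt t X = X := by
  funext r ω
  by_cases hr : t ≤ r
  · simp [projt, hr]
  · simp [projt, hr, h r (not_le.mp hr) ω]

theorem memRt_projt {Ω : Type*} {m : MeasurableSpace Ω} {F : Filtration ℕ m} (t : ℕ)
    {X : ℕ → Ω → ℝ} (hX : MemRinf F X) : MemRt F t (projt t X) := by
  obtain ⟨hmeas, C, hC⟩ := hX
  refine ⟨⟨fun s => ?_, C, fun s ω => ?_⟩, fun r hr ω => by simp [projt, hr.not_ge]⟩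
  · by_cases hs : t ≤ s
    · simpa +unfoldPartialApp [projt, hs] using hmeas s
    · simp +unfoldPartialApp [projt, hs]
  · by_cases hs : t ≤ s
    · simpa [projt, hs] using hC s ω
    · simpa [projt, hs] using (abs_nonneg _).trans (hC s ω)

/-- **Weak acceptance consistency is equivalent to nestedness of the acceptance sets.**
A dynamic convex risk measure for processes `(ρ_t)` is weakly acceptance consistent
(`X_t = 0` a.s. and `ρ_{t+1}(X) ≤ 0` a.s. imply `ρ_t(X) ≤ 0` a.s.) if and only if
`𝒜_{t+1} ⊆ 𝒜_t` for every `t`. -/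
theorem stmt_11 {Ω : Type*} {m : MeasurableSpace Ω} (F : Filtration ℕ m)
    (P : Measure Ω) [IsProbabilityMeasure P]
    (hF0 : ∀ A : Set Ω, MeasurableSet[F 0] A → P A = 0 ∨ P A = 1)
    (ρ : ℕ → (ℕ → Ω → ℝ) → Ω → ℝ)
    (hρ : ∀ t, IsCondRiskMeasure F P t (ρ t)) :
    (∀ t, ∀ X : ℕ → Ω → ℝ, MemRinf F X →
        X t =ᵐ[P] (0 : Ω → ℝ) →
        (∀ᵐ ω ∂P, ρ (t + 1) (projt (t + 1) X) ω ≤ 0) →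
        ∀ᵐ ω ∂P, ρ t (projt t X) ω ≤ 0) ↔
      ∀ t, AcceptSet F P (t + 1) (ρ (t + 1)) ⊆ AcceptSet F P t (ρ t) := by
  constructor
  · rintro h t X ⟨hX, hle⟩
    have hproj : ∀ s ≤ t + 1, projt s X = X := fun s hs =>
      projt_eq_self fun r hr => hX.2 r (by omega)
    refine ⟨⟨hX.1, fun r hr => hX.2 r (by omega)⟩, ?_⟩
    have key := h t X hX.1 (Eventually.of_forall fun ω => hX.2 t (by omega) ω)
    rw [hproj (t + 1) le_rfl, hproj t (by omega)] at key
    exact key hle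
  · intro h t X hX hX0 hle
    have hmem := memRt_projt (t + 1) hX
    obtain ⟨hmem', hacc⟩ := h t ⟨hmem, hle⟩
    have hmono := (hρ t).mono (projt (t + 1) X) (projt t X) hmem' (memRt_projt t hX) ?_
    · filter_upwards [hmono, hacc] with ω h1 h2 using h1.trans h2
    · intro s
      filter_upwards [hX0] with ω hω
      rcases lt_trichotomy s t with hs | rfl | hs
      · simp [projt, hs.not_ge, show ¬ t + 1 ≤ s by omega]
      · simp [projt, hω]
      · simp [projt, hs.le, show t + 1 ≤ s by omega]
end
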